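/- arXiv:math/0005150 — 2 statements merged into one kernel-verified Lean document; each statement's English description precedes it below -/
import Mathlib

section
/- (Commutative case of Proposition 5.6, assertion 2, first part.) Let (Ω, μ) be an atomless probability space and 1 < p < 2. Let (f_n) be a weakly null sequence in L^p(μ) such that the family (|f_n|^p)_{n∈ℕ} is uniformly integrable. Then (f_n) has a strong p-Banach-Saks subsequence, i.e., a subsequence (g_n) such that lim_{n→∞} n^{-1/p} ‖∑_{j=1}^n y_j‖_{L^p(μ)} = 0 for every subsequence (y_j) of (g_n). -/
open MeasureTheory Filter
open scoped ENNReal NNReal BigOperators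

noncomputable section

variable {E : Type*} [NormedAddCommGroup E] [NormedSpace ℝ E]

/-- `x` is `K`-equivalent to the usual `ℓ^q` basis. -/
def IsLqBasisEquiv (q K : ℝ) (x : ℕ → E) : Prop :=
  ∀ (s : Finset ℕ) (a : ℕ → ℝ),
    (1 / K) * (∑ k ∈ s, |a k| ^ q) ^ (1 / q) ≤ ‖∑ k ∈ s, a k • x k‖ ∧
      ‖∑ k ∈ s, a k • x k‖ ≤ K * (∑ k ∈ s, |a k| ^ q) ^ (1 / q)

/-- `x` is `K`-equivalent to the usual `ℓ^q_n` basis. -/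
def IsLqBasisEquivFin (q K : ℝ) {n : ℕ} (x : Fin n → E) : Prop :=
  ∀ a : Fin n → ℝ,
    (1 / K) * (∑ k, |a k| ^ q) ^ (1 / q) ≤ ‖∑ k, a k • x k‖ ∧
      ‖∑ k, a k • x k‖ ≤ K * (∑ k, |a k| ^ q) ^ (1 / q)

/-- `x` is `u`-unconditional. -/
def IsUnconditionalWith (u : ℝ) (x : ℕ → E) : Prop :=
  ∀ (s : Finset ℕ) (c ε : ℕ → ℝ), (∀ k ∈ s, |ε k| = 1) →
    ‖∑ k ∈ s, (ε k * c k) • x k‖ ≤ u * ‖∑ k ∈ s, c k • x k‖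

/-- `x` is unconditional. -/
def IsUnconditional (x : ℕ → E) : Prop :=
  ∃ u : ℝ, 1 ≤ u ∧ IsUnconditionalWith u x

/-- Finite version of `u`-unconditionality. -/
def IsUnconditionalWithFin (u : ℝ) {n : ℕ} (x : Fin n → E) : Prop :=
  ∀ (c ε : Fin n → ℝ), (∀ k, |ε k| = 1) →
    ‖∑ k, (ε k * c k) • x k‖ ≤ u * ‖∑ k, c k • x k‖

/-- The measure `μ` is atomless: every measurable set of positive measure contains a
measurable subset of strictly smaller positive measure. -/
def Atomless {Ω : Type*} [MeasurableSpace Ω] (μ : Measure Ω) : Prop :=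
  ∀ A : Set Ω, MeasurableSet A → 0 < μ A →
    ∃ B, B ⊆ A ∧ MeasurableSet B ∧ 0 < μ B ∧ μ B < μ A

/-- The family `(|f n|^p)` is uniformly integrable. -/
def UnifIntPow {Ω : Type*} [MeasurableSpace Ω] (μ : Measure Ω) (p : ℝ) (f : ℕ → Ω → ℝ) : Prop :=
  ∀ ε : ℝ, 0 < ε → ∃ δ : ℝ, 0 < δ ∧ ∀ n, ∀ A : Set Ω, MeasurableSet A →
    μ A ≤ ENNReal.ofReal δ → ∫ x in A, |f n x| ^ p ∂μ ≤ ε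

/-- `(f n)` is weakly null in `L^p(μ)`. -/
def WeaklyNullLp {Ω : Type*} [MeasurableSpace Ω] (μ : Measure Ω) (p : ℝ≥0∞)
    (f : ℕ → Lp ℝ p μ) : Prop :=
  ∀ q : ℝ≥0∞, p⁻¹ + q⁻¹ = 1 → ∀ g : Lp ℝ q μ,
    Tendsto (fun n => ∫ x, (f n : Ω → ℝ) x * (g : Ω → ℝ) x ∂μ) atTop (nhds 0)

/-- The `p`-modulus of uniform integrability. -/
def omegaP {Ω : Type*} [MeasurableSpace Ω] (μ : Measure Ω) (p : ℝ) (f : Ω → ℝ) (ε : ℝ) : ℝ :=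
  sSup {r : ℝ | ∃ A : Set Ω, MeasurableSet A ∧ μ A ≤ ENNReal.ofReal ε ∧
    r = (∫ x in A, |f x| ^ p ∂μ) ^ (1 / p)}


/-- The smooth substitute `(r² + s²)^(p/2)` for `|s|^p` at scale `r`. -/
def smoothPow (r p s : ℝ) : ℝ := (r ^ 2 + s ^ 2) ^ (p / 2)

/-- The derivative of `smoothPow r p`. -/
def smoothPowDeriv (r p s : ℝ) : ℝ := p * s * (r ^ 2 + s ^ 2) ^ (p / 2 - 1)

lemma add_rpow_le_tangent {w h θ : ℝ} (hw : 0 < w) (hwh : 0 ≤ w + h) (h0 : 0 ≤ θ) (h1 : θ ≤ 1) :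
    (w + h) ^ θ ≤ w ^ θ + θ * w ^ (θ - 1) * h := by
  have hs : -1 ≤ h / w := by rw [le_div_iff₀ hw]; linarith
  have key := rpow_one_add_le_one_add_mul_self hs h0 h1
  have e : w + h = w * (1 + h / w) := by field_simp
  rw [e, Real.mul_rpow hw.le (by linarith), Real.rpow_sub hw, Real.rpow_one]
  calc w ^ θ * (1 + h / w) ^ θ ≤ w ^ θ * (1 + θ * (h / w)) := by gcongr
    _ = _ := by field_simp

lemma sq_rpow_half {a : ℝ} (ha : 0 ≤ a) (p : ℝ) : (a ^ 2) ^ (p / 2) = a ^ p := by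
  rw [← Real.rpow_natCast a 2, ← Real.rpow_mul ha]
  congr 1
  push_cast
  ring

lemma abs_rpow_le_smoothPow (r s : ℝ) {p : ℝ} (hp : 0 ≤ p) : |s| ^ p ≤ smoothPow r p s := by
  rw [← sq_rpow_half (abs_nonneg s), sq_abs]
  exact Real.rpow_le_rpow (sq_nonneg s) (by nlinarith [sq_nonneg r]) (by linarith)

lemma smoothPow_nonneg (r p s : ℝ) : 0 ≤ smoothPow r p s := by
  unfold smoothPow; positivity

lemma smoothPow_le {r p : ℝ} (hr : 0 ≤ r) (hp : 0 ≤ p) (s : ℝ) :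
    smoothPow r p s ≤ (r + |s|) ^ p := by
  rw [← sq_rpow_half (by positivity), smoothPow]
  exact Real.rpow_le_rpow (by positivity)
    (by nlinarith [sq_abs s, mul_nonneg hr (abs_nonneg s)]) (by linarith)

lemma abs_smoothPowDeriv_le (r s : ℝ) {p : ℝ} (hp0 : 0 < p) (hp2 : p < 2) :
    |smoothPowDeriv r p s| ≤ p * |s| ^ (p - 1) := by
  rcases eq_or_ne s 0 with rfl | hs
  · simp only [smoothPowDeriv, mul_zero, zero_mul, abs_zero]
    positivity
  have hs' : 0 < |s| := abs_pos.2 hs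
  have h1 : (r ^ 2 + s ^ 2) ^ (p / 2 - 1) ≤ |s| ^ (p - 2) := by
    rw [← sq_rpow_half hs'.le, sq_abs, sub_div, div_self two_ne_zero]
    exact Real.rpow_le_rpow_of_nonpos (by positivity) (by nlinarith [sq_nonneg r]) (by linarith)
  rw [smoothPowDeriv, abs_mul, abs_mul, abs_of_pos hp0, mul_assoc,
    abs_of_nonneg (by positivity : 0 ≤ (r ^ 2 + s ^ 2) ^ (p / 2 - 1))]
  have h2 : |s| ^ (p - 1) = |s| * |s| ^ (p - 2) := by
    rw [mul_comm, ← Real.rpow_add_one hs'.ne']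
    ring_nf
  rw [h2]
  gcongr

lemma smoothPow_add_le_quadratic {r p : ℝ} (hr : 0 < r) (hp0 : 0 ≤ p) (hp2 : p ≤ 2) (s b : ℝ) :
    smoothPow r p (s + b) ≤
      smoothPow r p s + smoothPowDeriv r p s * b + (r ^ 2 + s ^ 2) ^ (p / 2 - 1) * b ^ 2 := by
  have hw : 0 < r ^ 2 + s ^ 2 := by positivity
  have e : r ^ 2 + (s + b) ^ 2 = (r ^ 2 + s ^ 2) + (2 * s * b + b ^ 2) := by ring
  have key := add_rpow_le_tangent (θ := p / 2) hw (by rw [← e]; positivity)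
    (by linarith) (by linarith)
  rw [← e] at key
  have : 0 ≤ (r ^ 2 + s ^ 2) ^ (p / 2 - 1) * b ^ 2 := by positivity
  unfold smoothPow smoothPowDeriv
  nlinarith

lemma smoothPow_add_le_rpow {r p : ℝ} (hr : 0 < r) (hp1 : 1 < p) (hp2 : p < 2) (s b : ℝ) :
    smoothPow r p (s + b) ≤ smoothPow r p s + smoothPowDeriv r p s * b + 6 * |b| ^ p := by
  set w := r ^ 2 + s ^ 2 with hwdef
  have hw : 0 < w := by positivity
  have hbp : 0 ≤ |b| ^ p := by positivity
  rcases le_or_gt w (b ^ 2) with hwb | hwb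
  · have hb : 0 < |b| := by
      rw [abs_pos]; rintro rfl; norm_num at hwb; linarith
    have hsb : |s| ≤ |b| := sq_le_sq.1 (by nlinarith [sq_nonneg r])
    have h1 : smoothPow r p (s + b) ≤ 4 * |b| ^ p := by
      have h4 : (2 : ℝ) ^ p ≤ 4 := by
        calc (2 : ℝ) ^ p ≤ 2 ^ (2 : ℝ) := Real.rpow_le_rpow_of_exponent_le (by norm_num) hp2.le
          _ = 4 := by norm_num
      calc smoothPow r p (s + b) ≤ ((2 * |b|) ^ 2) ^ (p / 2) := by
            refine Real.rpow_le_rpow (by positivity) ?_ (by linarith)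
            rw [mul_pow, sq_abs]
            have : s * b ≤ b ^ 2 := by
              calc s * b ≤ |s * b| := le_abs_self _
                _ = |s| * |b| := abs_mul _ _
                _ ≤ |b| * |b| := by gcongr
                _ = b ^ 2 := by rw [← sq, sq_abs]
            nlinarith
        _ = 2 ^ p * |b| ^ p := by
            rw [sq_rpow_half (by positivity), Real.mul_rpow (by norm_num) hb.le]
        _ ≤ _ := by gcongr
    have h2 : |smoothPowDeriv r p s * b| ≤ 2 * |b| ^ p := by
      calc |smoothPowDeriv r p s * b| ≤ p * |s| ^ (p - 1) * |b| := by
            rw [abs_mul]; gcongr; exact abs_smoothPowDeriv_le r s (by linarith) hp2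
        _ ≤ 2 * |b| ^ (p - 1) * |b| := by
            have : 0 ≤ p - 1 := by linarith
            gcongr
        _ = 2 * |b| ^ p := by
            rw [mul_assoc, ← Real.rpow_add_one hb.ne']; ring_nf
    have := smoothPow_nonneg r p s
    have := (abs_le.1 h2).1
    linarith
  · refine (smoothPow_add_le_quadratic hr (by linarith) hp2.le s b).trans ?_
    rcases eq_or_ne b 0 with rfl | hb
    · simp [Real.zero_rpow (by linarith : p ≠ 0)]
    have hb' : 0 < |b| := abs_pos.2 hb
    have h1 : w ^ (p / 2 - 1) ≤ |b| ^ (p - 2) := by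
      rw [← sq_rpow_half hb'.le, sq_abs, sub_div, div_self two_ne_zero]
      exact Real.rpow_le_rpow_of_nonpos (by positivity) hwb.le (by linarith)
    have h2 : w ^ (p / 2 - 1) * b ^ 2 ≤ |b| ^ p := by
      calc w ^ (p / 2 - 1) * b ^ 2 ≤ |b| ^ (p - 2) * |b| ^ 2 := by rw [sq_abs]; gcongr
        _ = |b| ^ p := by
          rw [← Real.rpow_natCast |b| 2, ← Real.rpow_add hb']; congr 1; push_cast; ring
    linarith

lemma smoothPow_add_le {r p M : ℝ} (hr : 0 < r) (hp1 : 1 < p) (hp2 : p < 2) (s b : ℝ) :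
    smoothPow r p (s + b) ≤ smoothPow r p s + smoothPowDeriv r p s * b +
      ((r ^ 2) ^ (p / 2 - 1) * M ^ 2 + 6 * {b : ℝ | M < |b|}.indicator (fun b ↦ |b| ^ p) b) := by
  by_cases hb : M < |b|
  · rw [Set.indicator_of_mem (by exact hb)]
    have := smoothPow_add_le_rpow hr hp1 hp2 s b
    have : 0 ≤ (r ^ 2) ^ (p / 2 - 1) * M ^ 2 := by positivity
    linarith
  · rw [Set.indicator_of_notMem (by exact hb), mul_zero, add_zero]
    refine (smoothPow_add_le_quadratic hr (by linarith) hp2.le s b).trans ?_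
    have h1 : (r ^ 2 + s ^ 2) ^ (p / 2 - 1) ≤ (r ^ 2) ^ (p / 2 - 1) :=
      Real.rpow_le_rpow_of_nonpos (by positivity) (by nlinarith [sq_nonneg s]) (by linarith)
    have h2 : b ^ 2 ≤ M ^ 2 := sq_le_sq.2 ((not_lt.1 hb).trans (le_abs_self M))
    gcongr

lemma exists_strictMono_forall_subseq_le (T : ℕ → ℕ) :
    ∃ k : ℕ → ℕ, StrictMono k ∧
      ∀ m : ℕ → ℕ, StrictMono m → ∀ j, T (k (m j)) ≤ k (m (j + 1)) := by
  let k : ℕ → ℕ := Nat.rec 0 fun _ a ↦ max (T a) (a + 1)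
  have hk (j : ℕ) : k (j + 1) = max (T (k j)) (k j + 1) := rfl
  have hmono : StrictMono k := strictMono_nat_of_lt_succ fun j ↦ by rw [hk]; omega
  refine ⟨k, hmono, fun m hm j ↦ ?_⟩
  calc T (k (m j)) ≤ k (m j + 1) := by rw [hk]; exact le_max_left _ _
    _ ≤ k (m (j + 1)) := hmono.monotone (hm (Nat.lt_succ_self j))

lemma eventually_le_mul_of_increment_le {a : ℕ → ℝ} {c η : ℝ} (hcη : c < η)
    (h : ∀ᶠ n in atTop, a (n + 1) ≤ a n + c) : ∀ᶠ n : ℕ in atTop, a n ≤ η * n := by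
  obtain ⟨N, hN⟩ := eventually_atTop.1 h
  have hlin : ∀ n ≥ N, a n ≤ a N - c * N + c * n := fun n hn ↦ by
    induction n, hn using Nat.le_induction with
    | base => linarith
    | succ n hn ih => push_cast; linarith [hN n hn]
  have hlarge : ∀ᶠ n : ℕ in atTop, a N - c * N ≤ (η - c) * n :=
    (tendsto_natCast_atTop_atTop.const_mul_atTop (sub_pos.2 hcη)).eventually_ge_atTop _
  filter_upwards [eventually_ge_atTop N, hlarge] with n hn hn'
  linarith [hlin n hn]

section Integrals

variable {Ω : Type*} [MeasurableSpace Ω] {μ : Measure Ω} {p : ℝ}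

lemma integrable_abs_rpow_Lp (hp : 0 < p) (S : Lp ℝ (ENNReal.ofReal p) μ) :
    Integrable (fun x ↦ |S x| ^ p) μ := by
  simpa [ENNReal.toReal_ofReal hp.le] using
    (Lp.memLp S).integrable_norm_rpow (by simpa using hp) ENNReal.ofReal_ne_top

lemma norm_Lp_rpow (hp : 0 < p) (S : Lp ℝ (ENNReal.ofReal p) μ) :
    ‖S‖ ^ p = ∫ x, |S x| ^ p ∂μ := by
  have h : 0 ≤ ∫ x, |S x| ^ p ∂μ := by positivity
  rw [Lp.norm_def, (Lp.memLp S).eLpNorm_eq_integral_rpow_norm (by simpa using hp)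
    ENNReal.ofReal_ne_top]
  simp only [ENNReal.toReal_ofReal hp.le, Real.norm_eq_abs]
  rw [ENNReal.toReal_ofReal (by positivity), Real.rpow_inv_rpow h hp.ne']

lemma measurable_smoothPow (r p : ℝ) : Measurable (smoothPow r p) := by
  unfold smoothPow; fun_prop

lemma measurable_smoothPowDeriv (r p : ℝ) : Measurable (smoothPowDeriv r p) := by
  unfold smoothPowDeriv; fun_prop

lemma memLp_smoothPowDeriv (r : ℝ) (hp1 : 1 < p) (hp2 : p < 2)
    (S : Lp ℝ (ENNReal.ofReal p) μ) :
    MemLp (fun x ↦ smoothPowDeriv r p (S x))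
      (ENNReal.ofReal p / ENNReal.ofReal (p - 1)) μ := by
  have h := (Lp.memLp S).norm_rpow_div (ENNReal.ofReal (p - 1))
  refine (h.const_mul p).mono ((measurable_smoothPowDeriv r p).comp_aemeasurable
    (Lp.aestronglyMeasurable S).aemeasurable).aestronglyMeasurable (.of_forall fun x ↦ ?_)
  simp only [ENNReal.toReal_ofReal (by linarith : 0 ≤ p - 1), Real.norm_eq_abs]
  rw [abs_of_nonneg (by positivity : 0 ≤ p * |S x| ^ (p - 1))]
  exact abs_smoothPowDeriv_le r _ (by linarith) hp2

lemma inv_add_inv_dual_exponent (hp1 : 1 < p) :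
    (ENNReal.ofReal p)⁻¹ + (ENNReal.ofReal p / ENNReal.ofReal (p - 1))⁻¹ = 1 := by
  rw [ENNReal.inv_div (.inl ENNReal.ofReal_ne_top)
    (.inl (by simpa using hp1)), ← one_div, ENNReal.div_add_div_same,
    ← ENNReal.ofReal_one, ← ENNReal.ofReal_add zero_le_one (by linarith), add_sub_cancel]
  simp only [ENNReal.ofReal_one]
  exact ENNReal.div_self (by simp; linarith) ENNReal.ofReal_ne_top

lemma WeaklyNullLp.tendsto_integral_mul_smoothPowDeriv (hp1 : 1 < p) (hp2 : p < 2)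
    {f : ℕ → Lp ℝ (ENNReal.ofReal p) μ} (hf : WeaklyNullLp μ (ENNReal.ofReal p) f)
    (r : ℝ) (S : Lp ℝ (ENNReal.ofReal p) μ) :
    Tendsto (fun n ↦ ∫ x, f n x * smoothPowDeriv r p (S x) ∂μ) atTop (nhds 0) := by
  have hmem := memLp_smoothPowDeriv r hp1 hp2 S
  refine (hf _ (inv_add_inv_dual_exponent hp1) (hmem.toLp _)).congr fun n ↦ ?_
  refine integral_congr_ae ?_
  filter_upwards [hmem.coeFn_toLp] with x hx
  rw [hx]

lemma WeaklyNullLp.exists_almost_orthogonal (hp1 : 1 < p) (hp2 : p < 2)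
    {f : ℕ → Lp ℝ (ENNReal.ofReal p) μ} (hf : WeaklyNullLp μ (ENNReal.ofReal p) f) (N : ℕ) :
    ∃ T : ℕ, ∀ n, T ≤ n → ∀ A ⊆ Finset.range (N + 1), ∀ r ≤ N,
      ∫ x, f n x * smoothPowDeriv r p ((∑ i ∈ A, f i : Lp ℝ (ENNReal.ofReal p) μ) x) ∂μ
        ≤ 1 / ((N : ℝ) + 1) := by
  have h : ∀ᶠ n in atTop, ∀ A ∈ (Finset.range (N + 1)).powerset, ∀ r ∈ Finset.range (N + 1),
      ∫ x, f n x * smoothPowDeriv r p ((∑ i ∈ A, f i : Lp ℝ (ENNReal.ofReal p) μ) x) ∂μ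
        ≤ 1 / ((N : ℝ) + 1) := by
    rw [Filter.eventually_all_finset]
    intro A _
    rw [Filter.eventually_all_finset]
    intro r _
    exact (hf.tendsto_integral_mul_smoothPowDeriv hp1 hp2 r _).eventually_le_const (by positivity)
  obtain ⟨T, hT⟩ := eventually_atTop.1 h
  exact ⟨T, fun n hn A hA r hr ↦
    hT n hn A (Finset.mem_powerset.2 hA) r (Finset.mem_range.2 (by omega))⟩

variable [IsProbabilityMeasure μ]

lemma integrable_smoothPow {r : ℝ} (hr : 0 ≤ r) (hp : 0 < p) (S : Lp ℝ (ENNReal.ofReal p) μ) :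
    Integrable (fun x ↦ smoothPow r p (S x)) μ := by
  have h : MemLp (fun x ↦ r + |S x|) (ENNReal.ofReal p) μ :=
    (memLp_const r).add (Lp.memLp S).abs
  have h' := h.integrable_norm_rpow (by simpa using hp) ENNReal.ofReal_ne_top
  refine h'.mono ((measurable_smoothPow r p).comp_aemeasurable
    (Lp.aestronglyMeasurable S).aemeasurable).aestronglyMeasurable (.of_forall fun x ↦ ?_)
  simp only [ENNReal.toReal_ofReal hp.le, Real.norm_eq_abs]
  rw [abs_of_nonneg (smoothPow_nonneg r p _), abs_of_nonneg (by positivity : 0 ≤ r + |S x|),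
    abs_of_nonneg (by positivity)]
  exact smoothPow_le hr hp.le _

lemma integral_smoothPow_add_le {r M ε : ℝ} (hr : 0 < r) (hp1 : 1 < p) (hp2 : p < 2)
    (S b : Lp ℝ (ENNReal.ofReal p) μ) (hb : ∫ x in {x | M < |b x|}, |b x| ^ p ∂μ ≤ ε) :
    ∫ x, smoothPow r p ((S + b) x) ∂μ ≤ ∫ x, smoothPow r p (S x) ∂μ +
      ∫ x, b x * smoothPowDeriv r p (S x) ∂μ + ((r ^ 2) ^ (p / 2 - 1) * M ^ 2 + 6 * ε) := by
  have hp0 : 0 < p := by linarith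
  have : ENNReal.HolderConjugate (ENNReal.ofReal p)
    (ENNReal.ofReal p / ENNReal.ofReal (p - 1)) :=
    ENNReal.holderConjugate_iff.2 (inv_add_inv_dual_exponent hp1)
  have hI1 := integrable_smoothPow hr.le hp0 S
  have hI2 : Integrable (fun x ↦ b x * smoothPowDeriv r p (S x)) μ :=
    (Lp.memLp b).integrable_mul (memLp_smoothPowDeriv r hp1 hp2 S)
  have hm : MeasurableSet {x | M < |b x|} :=
    measurableSet_lt measurable_const (Lp.stronglyMeasurable b).measurable.abs
  have hI3 : Integrable ({x | M < |b x|}.indicator fun x ↦ |b x| ^ p) μ :=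
    (integrable_abs_rpow_Lp hp0 b).indicator hm
  have hI12 : Integrable (fun x ↦ smoothPow r p (S x) + b x * smoothPowDeriv r p (S x)) μ :=
    hI1.add hI2
  have hI4 : Integrable (fun x ↦ (r ^ 2) ^ (p / 2 - 1) * M ^ 2 +
      6 * {x | M < |b x|}.indicator (fun x ↦ |b x| ^ p) x) μ :=
    (integrable_const _).add (hI3.const_mul 6)
  calc ∫ x, smoothPow r p ((S + b) x) ∂μ
      ≤ ∫ x, ((smoothPow r p (S x) + b x * smoothPowDeriv r p (S x)) +
          ((r ^ 2) ^ (p / 2 - 1) * M ^ 2 +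
            6 * {x | M < |b x|}.indicator (fun x ↦ |b x| ^ p) x)) ∂μ := by
        refine integral_mono_ae (integrable_smoothPow hr.le hp0 _) (hI12.add hI4) ?_
        filter_upwards [Lp.coeFn_add S b] with x hx
        rw [hx, mul_comm (b x)]
        exact smoothPow_add_le hr hp1 hp2 (S x) (b x)
    _ = ∫ x, smoothPow r p (S x) ∂μ + ∫ x, b x * smoothPowDeriv r p (S x) ∂μ +
          ((r ^ 2) ^ (p / 2 - 1) * M ^ 2 + 6 * ∫ x in {x | M < |b x|}, |b x| ^ p ∂μ) := by
        rw [integral_add hI12 hI4, integral_add hI1 hI2,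
          integral_add (integrable_const _) (hI3.const_mul 6),
          integral_const_mul (6 : ℝ), integral_indicator hm]
        simp
    _ ≤ _ := by gcongr

lemma WeaklyNullLp.exists_integral_abs_le (hp1 : 1 < p) [Fact (1 ≤ ENNReal.ofReal p)]
    {f : ℕ → Lp ℝ (ENNReal.ofReal p) μ} (hf : WeaklyNullLp μ (ENNReal.ofReal p) f) :
    ∃ C, ∀ n, ∫ x, |f n x| ∂μ ≤ C := by
  set q := ENNReal.ofReal p / ENNReal.ofReal (p - 1)
  have : ENNReal.HolderConjugate (ENNReal.ofReal p) q :=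
    ENNReal.holderConjugate_iff.2 (inv_add_inv_dual_exponent hp1)
  have hq1 : Fact (1 ≤ q) := ⟨ENNReal.HolderConjugate.one_le q (ENNReal.ofReal p)⟩
  let T : ℕ → Lp ℝ q μ →L[ℝ] ℝ := fun n ↦
    (ContinuousLinearMap.mul ℝ ℝ).lpPairing μ (ENNReal.ofReal p) q (f n)
  have hT (n : ℕ) (g : Lp ℝ q μ) : T n g = ∫ x, f n x * g x ∂μ :=
    ContinuousLinearMap.lpPairing_eq_integral _ _ _
  obtain ⟨C, hC⟩ := banach_steinhaus (g := T) fun g ↦ by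
    have h := (hf q (inv_add_inv_dual_exponent hp1) g).norm.bddAbove_range
    obtain ⟨c, hc⟩ := h
    exact ⟨c, fun n ↦ by rw [hT]; exact hc ⟨n, rfl⟩⟩
  refine ⟨C, fun n ↦ ?_⟩
  have hm : MeasurableSet {x | 0 ≤ f n x} :=
    measurableSet_le measurable_const (Lp.stronglyMeasurable (f n)).measurable
  set sgn : Ω → ℝ := fun x ↦ if 0 ≤ f n x then 1 else -1 with hsgn
  have hsgn1 : ∀ᵐ x ∂μ, ‖sgn x‖ ≤ 1 := .of_forall fun x ↦ by
    simp only [hsgn]; split_ifs <;> simp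
  have hmem : MemLp sgn q μ := .of_bound
    (Measurable.ite hm measurable_const measurable_const).aestronglyMeasurable 1 hsgn1
  have hnorm : ‖hmem.toLp sgn‖ ≤ 1 := by
    have hsgn2 : ∀ᵐ x ∂μ, ‖hmem.toLp sgn x‖ ≤ 1 := by
      filter_upwards [hmem.coeFn_toLp, hsgn1] with x hx h1
      rwa [hx]
    simpa [measureUnivNNReal] using Lp.norm_le_of_ae_bound zero_le_one hsgn2
  have hC0 : 0 ≤ C := (norm_nonneg _).trans (hC n)
  calc ∫ x, |f n x| ∂μ = T n (hmem.toLp sgn) := by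
        rw [hT]
        refine integral_congr_ae ?_
        filter_upwards [hmem.coeFn_toLp] with x hx
        rw [hx]
        simp only [hsgn]
        split_ifs with h
        · rw [abs_of_nonneg h, mul_one]
        · rw [abs_of_neg (not_le.1 h), mul_neg_one]
    _ ≤ ‖T n (hmem.toLp sgn)‖ := le_abs_self _
    _ ≤ ‖T n‖ * ‖hmem.toLp sgn‖ := (T n).le_opNorm _
    _ ≤ C * 1 := by gcongr; exact hC n
    _ = C := mul_one C

lemma UnifIntPow.exists_tail_le [Fact (1 ≤ ENNReal.ofReal p)]
    {f : ℕ → Lp ℝ (ENNReal.ofReal p) μ} (hf : UnifIntPow μ p fun n ↦ (f n : Ω → ℝ))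
    {C : ℝ} (hC : ∀ n, ∫ x, |f n x| ∂μ ≤ C) {ε : ℝ} (hε : 0 < ε) :
    ∃ M : ℝ, ∀ n, ∫ x in {x | M < |f n x|}, |f n x| ^ p ∂μ ≤ ε := by
  obtain ⟨δ, hδ, h⟩ := hf ε hε
  have hC0 : 0 ≤ C := (by positivity : (0 : ℝ) ≤ ∫ x, |f 0 x| ∂μ).trans (hC 0)
  have hM : 0 < (C + 1) / δ := by positivity
  refine ⟨(C + 1) / δ, fun n ↦ h n _
    (measurableSet_lt measurable_const (Lp.stronglyMeasurable (f n)).measurable.abs) ?_⟩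
  have hint : Integrable (fun x ↦ |f n x|) μ :=
    ((Lp.memLp (f n)).integrable Fact.out).abs
  have h1 := mul_meas_ge_le_integral_of_nonneg (.of_forall fun x ↦ abs_nonneg (f n x)) hint
    ((C + 1) / δ)
  have h2 : μ.real {x | (C + 1) / δ ≤ |f n x|} ≤ δ := by
    have h3 := h1.trans (hC n)
    rw [div_mul_eq_mul_div, div_le_iff₀ hδ] at h3
    nlinarith
  calc μ {x | (C + 1) / δ < |f n x|} ≤ μ {x | (C + 1) / δ ≤ |f n x|} :=
        measure_mono (Set.ofPred_subset_ofPred.2 fun x hx ↦ hx.le)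
    _ = ENNReal.ofReal (μ.real {x | (C + 1) / δ ≤ |f n x|}) := by simp
    _ ≤ ENNReal.ofReal δ := ENNReal.ofReal_le_ofReal h2

lemma eventually_norm_sum_rpow_le (hp1 : 1 < p) (hp2 : p < 2)
    {g : ℕ → Lp ℝ (ENNReal.ofReal p) μ}
    (htail : ∀ ε > 0, ∃ M : ℝ, ∀ n, ∫ x in {x | M < |g n x|}, |g n x| ^ p ∂μ ≤ ε)
    (hcross : ∀ r j : ℕ, r ≤ j → ∫ x, g (j + 1) x *
      smoothPowDeriv r p ((∑ i ∈ Finset.range (j + 1), g i : Lp ℝ (ENNReal.ofReal p) μ) x) ∂μ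
        ≤ 1 / ((j : ℝ) + 1))
    {η : ℝ} (hη : 0 < η) : ∀ᶠ n : ℕ in atTop, ‖∑ i ∈ Finset.range n, g i‖ ^ p ≤ η * n := by
  have hp0 : 0 < p := by linarith
  let S : ℕ → Lp ℝ (ENNReal.ofReal p) μ := fun n ↦ ∑ i ∈ Finset.range n, g i
  change ∀ᶠ n : ℕ in atTop, ‖S n‖ ^ p ≤ η * n
  obtain ⟨M, hM⟩ := htail (η / 24) (by positivity)
  have hlim : Tendsto (fun r : ℕ ↦ ((r : ℝ) ^ 2) ^ (p / 2 - 1) * M ^ 2) atTop (nhds 0) := by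
    have h1 : Tendsto (fun r : ℕ ↦ (r : ℝ) ^ 2) atTop atTop :=
      (tendsto_pow_atTop two_ne_zero).comp tendsto_natCast_atTop_atTop
    have h2 := (tendsto_rpow_neg_atTop (by linarith : 0 < 1 - p / 2)).comp h1
    simpa [Function.comp_def] using h2.mul_const (M ^ 2)
  obtain ⟨r, hr, hr0⟩ :=
    ((hlim.eventually_le_const (by positivity : 0 < η / 4)).and (eventually_gt_atTop 0)).exists
  have hr0' : (0 : ℝ) < r := by exact_mod_cast hr0
  have hbound : ∀ᶠ n : ℕ in atTop, ∫ x, smoothPow r p (S n x) ∂μ ≤ η * n := by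
    refine eventually_le_mul_of_increment_le (c := η / 4 + (η / 4 + 6 * (η / 24)))
      (by linarith) ?_
    have hsmall := (tendsto_one_div_add_atTop_nhds_zero_nat (𝕜 := ℝ)).eventually_le_const
      (by positivity : 0 < η / 4)
    obtain ⟨N, hN⟩ := eventually_atTop.1 (hsmall.and (eventually_ge_atTop r))
    filter_upwards [eventually_ge_atTop (N + 1)] with n hn
    obtain ⟨j, rfl⟩ := Nat.exists_eq_add_of_le' ((Nat.succ_pos N).trans_le hn)
    obtain ⟨hj, hrj⟩ := hN j (Nat.le_of_succ_le_succ hn)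
    have h := integral_smoothPow_add_le hr0' hp1 hp2 (S (j + 1)) (g (j + 1)) (hM (j + 1))
    have hs : S (j + 1 + 1) = S (j + 1) + g (j + 1) := Finset.sum_range_succ _ _
    rw [hs]
    linarith [hcross r j hrj]
  filter_upwards [hbound] with n hn
  rw [norm_Lp_rpow hp0]
  refine le_trans (integral_mono (integrable_abs_rpow_Lp hp0 _)
    (integrable_smoothPow hr0'.le hp0 _) fun x ↦ abs_rpow_le_smoothPow _ _ hp0.le) hn

end Integrals

/-- (Commutative case of Proposition 5.6, assertion 2, first part.) -/
theorem statement18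
    {Ω : Type*} [MeasurableSpace Ω] (μ : Measure Ω) [IsProbabilityMeasure μ]
    (hμ : Atomless μ)
    (p : ℝ) (hp1 : 1 < p) (hp2 : p < 2)
    [Fact (1 ≤ ENNReal.ofReal p)]
    (f : ℕ → Lp ℝ (ENNReal.ofReal p) μ)
    (hweak : WeaklyNullLp μ (ENNReal.ofReal p) f)
    (hui : UnifIntPow μ p fun n => (f n : Ω → ℝ)) :
    ∃ k : ℕ → ℕ, StrictMono k ∧ ∀ m : ℕ → ℕ, StrictMono m →
      Tendsto (fun n : ℕ => (n : ℝ) ^ (-(1 / p)) * ‖∑ j ∈ Finset.range n, f (k (m j))‖)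
        atTop (nhds 0) := by
  have hp0 : 0 < p := by linarith
  choose T hT using fun N ↦ hweak.exists_almost_orthogonal hp1 hp2 N
  obtain ⟨k, hk, hkT⟩ := exists_strictMono_forall_subseq_le T
  refine ⟨k, hk, fun m hm ↦ ?_⟩
  obtain ⟨C, hC⟩ := hweak.exists_integral_abs_le hp1
  have hu : StrictMono fun j ↦ k (m j) := hk.comp hm
  set S : ℕ → Lp ℝ (ENNReal.ofReal p) μ := fun n ↦ ∑ j ∈ Finset.range n, f (k (m j))
  have hcross (r j : ℕ) (hrj : r ≤ j) :
      ∫ x, f (k (m (j + 1))) x * smoothPowDeriv r p (S (j + 1) x) ∂μ ≤ 1 / ((j : ℝ) + 1) := by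
    have hj : j ≤ k (m j) := hu.id_le j
    have hsum : S (j + 1) = ∑ i ∈ (Finset.range (j + 1)).image fun j ↦ k (m j), f i := by
      rw [Finset.sum_image hu.injective.injOn]
    rw [hsum]
    refine (hT _ _ (hkT m hm j) _ ?_ r (hrj.trans hj)).trans ?_
    · intro i hi
      obtain ⟨l, hl, rfl⟩ := Finset.mem_image.1 hi
      have := hu.monotone (Nat.lt_succ_iff.1 (Finset.mem_range.1 hl))
      exact Finset.mem_range.2 (Nat.lt_succ_of_le this)
    · gcongr
  have hgrowth (η : ℝ) (hη : 0 < η) : ∀ᶠ n : ℕ in atTop, ‖S n‖ ^ p ≤ η * n :=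
    eventually_norm_sum_rpow_le hp1 hp2 (g := fun j ↦ f (k (m j)))
      (fun ε hε ↦ (hui.exists_tail_le hC hε).imp fun M hM n ↦ hM _) hcross hη
  rw [tendsto_order]
  refine ⟨fun a ha ↦ .of_forall fun n ↦ ha.trans_le (by positivity), fun a ha ↦ ?_⟩
  filter_upwards [hgrowth ((a / 2) ^ p) (by positivity), eventually_gt_atTop 0] with n hn hn0
  have hn0' : (0 : ℝ) < n := by exact_mod_cast hn0
  have h1 : ‖S n‖ ≤ a / 2 * (n : ℝ) ^ (1 / p) := by
    rw [← Real.rpow_le_rpow_iff (norm_nonneg _) (by positivity) hp0,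
      Real.mul_rpow (by positivity) (by positivity), ← Real.rpow_mul hn0'.le,
      one_div_mul_cancel hp0.ne', Real.rpow_one]
    exact hn
  calc (n : ℝ) ^ (-(1 / p)) * ‖S n‖ ≤ (n : ℝ) ^ (-(1 / p)) * (a / 2 * (n : ℝ) ^ (1 / p)) := by
        gcongr
    _ = a / 2 := by
        rw [Real.rpow_neg hn0'.le]
        field_simp
    _ < a := by linarith

end
end

section
/- (Commutative case of Proposition 5.6, assertion 2, second part.) Let (Ω, μ) be an atomless probability space and 1 < p < 2. Let (f_n) be a bounded weakly null sequence in L^p(μ) such that the family (|f_n|^p)_{n∈ℕ} is NOT uniformly integrable. Then (f_n) has a subsequence (f'_n) such that for some constant c > 0 and every subsequence (y_j) of (f'_j): liminf_{n→∞} n^{-1/p} ‖∑_{j=1}^n y_j‖_{L^p(μ)} ≥ c. -/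
open MeasureTheory Filter
open scoped ENNReal NNReal BigOperators

noncomputable section

variable {E : Type*} [NormedAddCommGroup E] [NormedSpace ℝ E]

open Finset in
/-- A sequence can be selected recursively when each choice depends only on the finite set of
previous choices. -/
theorem exists_seq_forall_image_range {α : Type*} [DecidableEq α] {Q : Finset α → α → Prop}
    (h : ∀ s, ∃ x, Q s x) : ∃ x : ℕ → α, ∀ N, Q ((range N).image x) (x N) := by
  choose g hg using h
  let st : ℕ → Finset α := fun N => Nat.rec ∅ (fun _ s => insert (g s) s) N
  have hst : ∀ N, (range N).image (fun j => g (st j)) = st N := by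
    intro N
    induction N with
    | zero => simp [st]
    | succ N ih => rw [range_add_one, image_insert, ih]
  exact ⟨fun j => g (st j), fun N => by rw [hst]; exact hg _⟩

/-- The signed power `sign t * |t| ^ (p - 1)`. -/
def signedPow (p t : ℝ) : ℝ := t * |t| ^ (p - 2)

theorem measurable_signedPow (p : ℝ) : Measurable (signedPow p) :=
  measurable_id.mul (by fun_prop)

theorem signedPow_mul_self {p : ℝ} (hp : 0 < p) (t : ℝ) : signedPow p t * t = |t| ^ p := by
  rcases eq_or_ne t 0 with rfl | ht
  · simp [signedPow, Real.zero_rpow hp.ne']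
  · have h : 0 < |t| := abs_pos.mpr ht
    have : |t| ^ p = |t| ^ (p - 2) * |t| ^ (2 : ℕ) := by
      rw [← Real.rpow_natCast, ← Real.rpow_add h]; norm_num
    rw [this, sq_abs, signedPow]; ring

theorem abs_signedPow_rpow {p q : ℝ} (hpq : p.HolderConjugate q) (t : ℝ) :
    |signedPow p t| ^ q = |t| ^ p := by
  rcases eq_or_ne t 0 with rfl | ht
  · simp [signedPow, Real.zero_rpow hpq.ne_zero, Real.zero_rpow hpq.symm.ne_zero]
  · have h : 0 < |t| := abs_pos.mpr ht
    have h1 : |signedPow p t| = |t| ^ (p - 1) := by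
      rw [signedPow, abs_mul, abs_of_nonneg (Real.rpow_nonneg h.le _)]
      nth_rewrite 1 [← Real.rpow_one |t|]
      rw [← Real.rpow_add h]; congr 1; ring
    rw [h1, ← Real.rpow_mul h.le, hpq.sub_one_mul_conj]

theorem abs_one_add_rpow_le {p : ℝ} (hp1 : 1 < p) (hp2 : p < 2) (t : ℝ) :
    |1 + t| ^ p ≤ 1 + p * t + 6 * |t| ^ p := by
  rcases le_or_gt |t| 1 with h | h
  · have ht := abs_le.mp h
    have h0 : 0 ≤ 1 + t := by linarith
    have h1 : |1 + t| ^ p = (1 + t) ^ (p - 1) * (1 + t) := by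
      rw [abs_of_nonneg h0]
      nth_rewrite 3 [← Real.rpow_one (1 + t)]
      rw [← Real.rpow_add' h0 (by linarith)]; congr 1; ring
    have h2 : (1 + t) ^ (p - 1) ≤ 1 + (p - 1) * t :=
      rpow_one_add_le_one_add_mul_self ht.1 (by linarith) (by linarith)
    have h3 : t ^ 2 ≤ |t| ^ p := by
      rw [← sq_abs, ← Real.rpow_natCast]
      rcases (abs_nonneg t).eq_or_lt with h4 | h4
      · rw [← h4, Real.zero_rpow (by norm_num), Real.zero_rpow (by linarith)]
      · exact Real.rpow_le_rpow_of_exponent_ge h4 h (by norm_num; linarith)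
    rw [h1]
    nlinarith [mul_le_mul_of_nonneg_right h2 h0, sq_nonneg t]
  · have h1 : |1 + t| ≤ 2 * |t| := (abs_add_le 1 t).trans (by rw [abs_one]; linarith)
    have h2 : |1 + t| ^ p ≤ 4 * |t| ^ p := by
      refine (Real.rpow_le_rpow (abs_nonneg _) h1 (by linarith)).trans ?_
      rw [Real.mul_rpow (by norm_num) (abs_nonneg _)]
      gcongr
      calc (2 : ℝ) ^ p ≤ 2 ^ (2 : ℝ) := Real.rpow_le_rpow_of_exponent_le (by norm_num) hp2.le
        _ = 4 := by norm_num
    have h3 : |t| ≤ |t| ^ p := by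
      simpa using Real.rpow_le_rpow_of_exponent_le h.le hp1.le
    nlinarith [neg_abs_le t]

theorem abs_add_rpow_le {p : ℝ} (hp1 : 1 < p) (hp2 : p < 2) (a b : ℝ) :
    |a + b| ^ p ≤ |a| ^ p + p * (signedPow p a * b) + 6 * |b| ^ p := by
  rcases eq_or_ne a 0 with rfl | ha
  · have := Real.rpow_nonneg (abs_nonneg b) p
    simp [signedPow, Real.zero_rpow (by linarith : p ≠ 0)]
    linarith
  · have h := mul_le_mul_of_nonneg_left (abs_one_add_rpow_le hp1 hp2 (b / a))
      (Real.rpow_nonneg (abs_nonneg a) p)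
    have h1 : |a| ^ p * |1 + b / a| ^ p = |a + b| ^ p := by
      rw [← Real.mul_rpow (abs_nonneg _) (abs_nonneg _), ← abs_mul]; congr 2; field_simp
    have h2 : |a| ^ p * |b / a| ^ p = |b| ^ p := by
      rw [← Real.mul_rpow (abs_nonneg _) (abs_nonneg _), ← abs_mul]; congr 2; field_simp
    have h3 : |a| ^ p * (b / a) = signedPow p a * b := by
      rw [← signedPow_mul_self (by linarith) a]; field_simp
    rw [h1] at h
    linear_combination h + p * h3 + 6 * h2

theorem abs_add_rpow_le_two_rpow {q : ℝ} (hq : 1 ≤ q) (a b : ℝ) :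
    |a + b| ^ q ≤ 2 ^ (q - 1) * (|a| ^ q + |b| ^ q) :=
  (Real.rpow_le_rpow (abs_nonneg _) (abs_add_le a b) (by linarith)).trans
    (by exact_mod_cast NNReal.rpow_add_le_mul_rpow_add_rpow ‖a‖₊ ‖b‖₊ hq)

/-- For `x = (n, A)`, the function `|F n| ^ (p - 1) * sign (F n)` restricted to `A`. -/
def testFun {Ω : Type*} (p : ℝ) (F : ℕ → Ω → ℝ) (x : ℕ × Set Ω) : Ω → ℝ :=
  x.2.indicator fun ω => signedPow p (F x.1 ω)

theorem abs_testFun_rpow_le {Ω : Type*} {p q : ℝ} (hpq : p.HolderConjugate q)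
    (F : ℕ → Ω → ℝ) (x : ℕ × Set Ω) (ω : Ω) : |testFun p F x ω| ^ q ≤ |F x.1 ω| ^ p := by
  by_cases h : ω ∈ x.2
  · rw [testFun, Set.indicator_of_mem h, abs_signedPow_rpow hpq]
  · rw [testFun, Set.indicator_of_notMem h, abs_zero, Real.zero_rpow hpq.symm.ne_zero]
    positivity

section Integrals

variable {Ω : Type*} [MeasurableSpace Ω] {μ : Measure Ω}

theorem MeasureTheory.MemLp.integrable_abs_rpow {p : ℝ} (hp : 0 < p) {s : Ω → ℝ}
    (hs : MemLp s (ENNReal.ofReal p) μ) : Integrable (fun x => |s x| ^ p) μ := by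
  have := hs.integrable_norm_rpow (by simpa using hp) ENNReal.ofReal_ne_top
  simpa [ENNReal.toReal_ofReal hp.le] using this

theorem MeasureTheory.MemLp.signedPow_comp {p q : ℝ} (hpq : p.HolderConjugate q) {s : Ω → ℝ}
    (hs : MemLp s (ENNReal.ofReal p) μ) :
    MemLp (fun x => signedPow p (s x)) (ENNReal.ofReal q) μ := by
  have hm : AEStronglyMeasurable (fun x => signedPow p (s x)) μ :=
    ((measurable_signedPow p).comp_aemeasurable hs.1.aemeasurable).aestronglyMeasurable
  rw [← integrable_norm_rpow_iff hm (by simpa using hpq.symm.pos) ENNReal.ofReal_ne_top,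
    ENNReal.toReal_ofReal hpq.symm.nonneg]
  simpa [abs_signedPow_rpow hpq] using hs.integrable_abs_rpow hpq.pos

theorem abs_integral_mul_le_rpow {p q : ℝ} (hpq : p.HolderConjugate q) {s g : Ω → ℝ}
    (hs : MemLp s (ENNReal.ofReal p) μ) (hg : MemLp g (ENNReal.ofReal q) μ) :
    |∫ x, g x * s x ∂μ| ≤ (∫ x, |g x| ^ q ∂μ) ^ (1 / q) * (∫ x, |s x| ^ p ∂μ) ^ (1 / p) := by
  refine (abs_integral_le_integral_abs).trans ?_
  simp only [abs_mul]
  exact integral_mul_norm_le_Lp_mul_Lq hpq.symm hg hs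

theorem integrable_mul_of_holderConjugate {p q : ℝ} (hpq : p.HolderConjugate q) {s g : Ω → ℝ}
    (hs : MemLp s (ENNReal.ofReal p) μ) (hg : MemLp g (ENNReal.ofReal q) μ) :
    Integrable (fun x => g x * s x) μ := by
  have : ENNReal.HolderConjugate (ENNReal.ofReal q) (ENNReal.ofReal p) := hpq.symm.ennrealOfReal
  exact hg.integrable_mul hs

/-- If `|F n| ^ p` is not uniformly integrable, then a fixed amount of mass of `|F n| ^ p`
lives on arbitrarily small sets for arbitrarily large `n`. -/
theorem exists_frequently_le_setIntegral {p : ℝ} {F : ℕ → Ω → ℝ}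
    (hF : ∀ n, Integrable (fun x => |F n x| ^ p) μ) (h : ¬ UnifIntPow μ p F) :
    ∃ ε : ℝ, 0 < ε ∧ ∃ᶠ x : ℕ × Set Ω in atTop ×ˢ comap μ (nhds 0),
      MeasurableSet x.2 ∧ ε ≤ ∫ ω in x.2, |F x.1 ω| ^ p ∂μ := by
  contrapose! h
  intro ε hε
  have h1 := h ε hε
  rw [eventually_prod_iff] at h1
  obtain ⟨pa, ha, pb, hb, hab⟩ := h1
  obtain ⟨N, hN⟩ := eventually_atTop.mp ha
  have h2 : ∀ᶠ A : Set Ω in comap μ (nhds 0), ∀ n ∈ Finset.range N,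
      ∫ ω in A, |F n ω| ^ p ∂μ < ε := by
    rw [eventually_all_finset]
    intro n _
    exact ((hF n).tendsto_setIntegral_nhds_zero
      (l := comap μ (nhds 0)) (s := id) tendsto_comap).eventually_lt_const hε
  have h3 := (hb.and h2)
  rw [eventually_comap] at h3
  obtain ⟨δ, hδ, hδ'⟩ := ENNReal.nhds_zero_basis_Iic.eventually_iff.mp h3
  refine ⟨(min δ 1).toReal, ENNReal.toReal_pos (by simpa using hδ.ne') (by simp), ?_⟩
  intro n A hA hμA
  rw [ENNReal.ofReal_toReal (by simp)] at hμA
  obtain ⟨h4, h5⟩ := hδ' (Set.mem_Iic.mpr (hμA.trans (min_le_left _ _))) A rfl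
  rcases lt_or_ge n N with hn | hn
  · exact (h5 n (by simpa using hn)).le
  · exact (hab (hN n hn) h4 hA).le

theorem integral_testFun_mul {p : ℝ} {F : ℕ → Ω → ℝ} {x : ℕ × Set Ω} (hx : MeasurableSet x.2)
    (s : Ω → ℝ) :
    ∫ ω, testFun p F x ω * s ω ∂μ = ∫ ω in x.2, signedPow p (F x.1 ω) * s ω ∂μ := by
  rw [← integral_indicator hx]
  simp only [testFun, Set.indicator_mul_left]

/-- The conditions imposed on the next pair `x = (n, A)` of an index and a set where `|F n| ^ p`
concentrates, given the finite set `s` of the pairs selected before. -/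
structure GoodStep (μ : Measure Ω) (p q ε : ℝ) (F : ℕ → Ω → ℝ) (s : Finset (ℕ × Set Ω))
    (x : ℕ × Set Ω) : Prop where
  measurableSet : MeasurableSet x.2
  mass : ε ≤ ∫ ω in x.2, |F x.1 ω| ^ p ∂μ
  lt : ∀ y ∈ s, y.1 < x.1
  sum_signedPow : ∀ T ∈ s.powerset, |∫ ω, signedPow p (∑ y ∈ T, F y.1 ω) * F x.1 ω ∂μ| ≤ 1
  sum_testFun : ∀ T ∈ s.powerset, ∫ ω in x.2, |∑ y ∈ T, testFun p F y ω| ^ q ∂μ ≤ 1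
  testFun_old : ∀ y ∈ s, |∫ ω, testFun p F y ω * F x.1 ω ∂μ| ≤ ε / 4 / (s.card + 1)
  testFun_new : ∀ y ∈ s, |∫ ω, testFun p F x ω * F y.1 ω ∂μ| ≤ ε / 4 / (s.card + 1)

theorem memLp_testFun {p q : ℝ} (hpq : p.HolderConjugate q) {F : ℕ → Ω → ℝ}
    (hF : ∀ n, MemLp (F n) (ENNReal.ofReal p) μ) {x : ℕ × Set Ω} (hx : MeasurableSet x.2) :
    MemLp (testFun p F x) (ENNReal.ofReal q) μ :=
  ((hF x.1).signedPow_comp hpq).indicator hx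

theorem tendsto_integral_testFun_mul {p q : ℝ} (hpq : p.HolderConjugate q) {F : ℕ → Ω → ℝ}
    (hF : ∀ n, MemLp (F n) (ENNReal.ofReal p) μ) {B : ℝ} (hB : ∀ n, ∫ ω, |F n ω| ^ p ∂μ ≤ B)
    {s : Ω → ℝ} (hs : MemLp s (ENNReal.ofReal p) μ) {c : ℝ} (hc : 0 < c) :
    ∀ᶠ x : ℕ × Set Ω in atTop ×ˢ comap μ (nhds 0), MeasurableSet x.2 →
      |∫ ω, testFun p F x ω * s ω ∂μ| ≤ c := by
  have h1 : Tendsto (fun x : ℕ × Set Ω => B ^ (1 / q) * (∫ ω in x.2, |s ω| ^ p ∂μ) ^ (1 / p))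
      (atTop ×ˢ comap μ (nhds 0)) (nhds 0) := by
    have := ((hs.integrable_abs_rpow hpq.pos).tendsto_setIntegral_nhds_zero
      (l := atTop ×ˢ comap μ (nhds 0)) (s := fun x : ℕ × Set Ω => x.2)
      (tendsto_comap.comp tendsto_snd))
    have h2 := (this.rpow_const (p := 1 / p) (Or.inr (by have := hpq.pos; positivity))).const_mul
      (B ^ (1 / q))
    rwa [Real.zero_rpow (by have := hpq.pos; positivity), mul_zero] at h2
  filter_upwards [h1.eventually_le_const hc] with x hx hm
  rw [integral_testFun_mul hm]
  refine (abs_integral_mul_le_rpow hpq (hs.restrict _)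
    (((hF x.1).signedPow_comp hpq).restrict _)).trans (le_trans ?_ hx)
  simp only [abs_signedPow_rpow hpq]
  gcongr
  · have := hpq.symm.pos; positivity
  · exact (setIntegral_le_integral ((hF x.1).integrable_abs_rpow hpq.pos)
      (ae_of_all _ fun ω => by positivity)).trans (hB x.1)

theorem exists_goodStep {p q : ℝ} (hpq : p.HolderConjugate q) {F : ℕ → Ω → ℝ}
    (hF : ∀ n, MemLp (F n) (ENNReal.ofReal p) μ) {B : ℝ} (hB : ∀ n, ∫ ω, |F n ω| ^ p ∂μ ≤ B)
    (hweak : ∀ g : Ω → ℝ, MemLp g (ENNReal.ofReal q) μ →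
      Tendsto (fun n => ∫ ω, g ω * F n ω ∂μ) atTop (nhds 0))
    {ε : ℝ} (hε : 0 < ε)
    (hfreq : ∃ᶠ x : ℕ × Set Ω in atTop ×ˢ comap μ (nhds 0),
      MeasurableSet x.2 ∧ ε ≤ ∫ ω in x.2, |F x.1 ω| ^ p ∂μ)
    (s : Finset (ℕ × Set Ω)) (hs : ∀ y ∈ s, MeasurableSet y.2) :
    ∃ x, GoodStep μ p q ε F s x := by
  have hsmall : ∀ g : Ω → ℝ, MemLp g (ENNReal.ofReal q) μ → ∀ c : ℝ, 0 < c →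
      ∀ᶠ x : ℕ × Set Ω in atTop ×ˢ comap μ (nhds 0), |∫ ω, g ω * F x.1 ω ∂μ| ≤ c := by
    intro g hg c hc
    have h := ((hweak g hg).comp (tendsto_fst (g := comap μ (nhds 0)))).abs
    rw [abs_zero] at h
    exact h.eventually_le_const hc
  have hc : 0 < ε / 4 / (s.card + 1) := by positivity
  have e1 : ∀ᶠ x : ℕ × Set Ω in atTop ×ˢ comap μ (nhds 0), ∀ y ∈ s, y.1 < x.1 :=
    (eventually_all_finset s).mpr fun y _ =>
      tendsto_fst.eventually (eventually_gt_atTop y.1)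
  have e2 : ∀ᶠ x : ℕ × Set Ω in atTop ×ˢ comap μ (nhds 0), ∀ T ∈ s.powerset,
      |∫ ω, signedPow p (∑ y ∈ T, F y.1 ω) * F x.1 ω ∂μ| ≤ 1 :=
    (eventually_all_finset _).mpr fun T _ =>
      hsmall _ ((memLp_finsetSum T fun y _ => hF y.1).signedPow_comp hpq) 1 one_pos
  have e3 : ∀ᶠ x : ℕ × Set Ω in atTop ×ˢ comap μ (nhds 0), ∀ T ∈ s.powerset,
      ∫ ω in x.2, |∑ y ∈ T, testFun p F y ω| ^ q ∂μ ≤ 1 := by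
    refine (eventually_all_finset _).mpr fun T hT => ?_
    have hm : MemLp (fun ω => ∑ y ∈ T, testFun p F y ω) (ENNReal.ofReal q) μ :=
      memLp_finsetSum T fun y hy => memLp_testFun hpq hF (hs y (Finset.mem_powerset.mp hT hy))
    exact ((hm.integrable_abs_rpow hpq.symm.pos).tendsto_setIntegral_nhds_zero
      (s := fun x : ℕ × Set Ω => x.2) (tendsto_comap.comp tendsto_snd)).eventually_le_const one_pos
  have e4 : ∀ᶠ x : ℕ × Set Ω in atTop ×ˢ comap μ (nhds 0), ∀ y ∈ s,
      |∫ ω, testFun p F y ω * F x.1 ω ∂μ| ≤ ε / 4 / (s.card + 1) :=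
    (eventually_all_finset s).mpr fun y hy => hsmall _ (memLp_testFun hpq hF (hs y hy)) _ hc
  have e5 : ∀ᶠ x : ℕ × Set Ω in atTop ×ˢ comap μ (nhds 0), ∀ y ∈ s, MeasurableSet x.2 →
      |∫ ω, testFun p F x ω * F y.1 ω ∂μ| ≤ ε / 4 / (s.card + 1) :=
    (eventually_all_finset s).mpr fun y _ => tendsto_integral_testFun_mul hpq hF hB (hF y.1) hc
  obtain ⟨x, ⟨hm, hmass⟩, h1, h2, h3, h4, h5⟩ :=
    (hfreq.and_eventually (e1.and (e2.and (e3.and (e4.and e5))))).exists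
  exact ⟨x, hm, hmass, h1, h2, h3, h4, fun y hy => h5 y hy hm⟩

section Sequence

open Finset

/-- The conditions on a sequence that are inherited by all its subsequences. -/
structure GoodSeq (μ : Measure Ω) (p q ε : ℝ) (F : ℕ → Ω → ℝ) (z : ℕ → ℕ × Set Ω) : Prop where
  measurableSet : ∀ n, MeasurableSet (z n).2
  mass : ∀ n, ε ≤ ∫ ω in (z n).2, |F (z n).1 ω| ^ p ∂μ
  sum_signedPow : ∀ n, |∫ ω, signedPow p (∑ j ∈ range n, F (z j).1 ω) * F (z n).1 ω ∂μ| ≤ 1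
  sum_testFun : ∀ n, ∫ ω in (z n).2, |∑ j ∈ range n, testFun p F (z j) ω| ^ q ∂μ ≤ 1
  testFun_old : ∀ n, ∀ j < n, |∫ ω, testFun p F (z j) ω * F (z n).1 ω ∂μ| ≤ ε / 4 / (n + 1)
  testFun_new : ∀ n, ∀ j < n, |∫ ω, testFun p F (z n) ω * F (z j).1 ω ∂μ| ≤ ε / 4 / (n + 1)

open Classical in
theorem goodSeq_comp {p q ε : ℝ} (hε : 0 < ε) {F : ℕ → Ω → ℝ} {x : ℕ → ℕ × Set Ω}
    (hx : ∀ N, GoodStep μ p q ε F ((range N).image x) (x N)) (hmono : StrictMono fun n => (x n).1)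
    {m : ℕ → ℕ} (hm : StrictMono m) : GoodSeq μ p q ε F (x ∘ m) := by
  have hinj : Function.Injective x := fun a b h => hmono.injective (congrArg Prod.fst h)
  have hinjm : Function.Injective (x ∘ m) := hinj.comp hm.injective
  have hmem : ∀ n, ∀ j < n, x (m j) ∈ (range (m n)).image x := fun n j hj =>
    mem_image_of_mem _ (mem_range.mpr (hm hj))
  have hsub : ∀ n, (range n).image (x ∘ m) ∈ ((range (m n)).image x).powerset := by
    intro n
    rw [mem_powerset, image_subset_iff]
    exact fun j hj => hmem n j (mem_range.mp hj)
  have hcard : ∀ n, ε / 4 / (((range (m n)).image x).card + 1 : ℝ) ≤ ε / 4 / (n + 1) := by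
    intro n
    rw [card_image_of_injective _ hinj, card_range]
    gcongr
    exact hm.le_apply
  refine ⟨fun n => (hx _).measurableSet, fun n => (hx _).mass, fun n => ?_, fun n => ?_,
    fun n j hj => ((hx (m n)).testFun_old _ (hmem n j hj)).trans (hcard n),
    fun n j hj => ((hx (m n)).testFun_new _ (hmem n j hj)).trans (hcard n)⟩
  · simpa [sum_image hinjm.injOn] using (hx (m n)).sum_signedPow _ (hsub n)
  · simpa [sum_image hinjm.injOn] using (hx (m n)).sum_testFun _ (hsub n)

variable {p q ε B : ℝ} {F : ℕ → Ω → ℝ} {z : ℕ → ℕ × Set Ω}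

theorem GoodSeq.integral_abs_sum_rpow_le (hz : GoodSeq μ p q ε F z) (hpq : p.HolderConjugate q)
    (hp2 : p < 2) (hF : ∀ n, MemLp (F n) (ENNReal.ofReal p) μ)
    (hB : ∀ n, ∫ ω, |F n ω| ^ p ∂μ ≤ B) (n : ℕ) :
    ∫ ω, |∑ j ∈ range n, F (z j).1 ω| ^ p ∂μ ≤ n * (2 + 6 * B) := by
  induction n with
  | zero => simp [Real.zero_rpow hpq.ne_zero]
  | succ n ih =>
    have hS : MemLp (fun ω => ∑ j ∈ range n, F (z j).1 ω) (ENNReal.ofReal p) μ :=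
      memLp_finsetSum _ fun j _ => hF _
    have i1 := hS.integrable_abs_rpow hpq.pos
    have i2 := (integrable_mul_of_holderConjugate hpq (hF (z n).1)
      (hS.signedPow_comp hpq)).const_mul p
    have i3 := ((hF (z n).1).integrable_abs_rpow hpq.pos).const_mul 6
    have h1 : ∫ ω, |∑ j ∈ range (n + 1), F (z j).1 ω| ^ p ∂μ ≤
        ∫ ω, (|∑ j ∈ range n, F (z j).1 ω| ^ p +
          p * (signedPow p (∑ j ∈ range n, F (z j).1 ω) * F (z n).1 ω)
            + 6 * |F (z n).1 ω| ^ p) ∂μ := by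
      refine integral_mono ((memLp_finsetSum _ fun j _ => hF _).integrable_abs_rpow hpq.pos)
        ((i1.fun_add i2).fun_add i3) fun ω => ?_
      simp only [sum_range_succ]
      exact abs_add_rpow_le hpq.lt hp2 _ _
    rw [integral_add (i1.fun_add i2) i3, integral_add i1 i2, integral_const_mul,
      integral_const_mul] at h1
    have h2 := (abs_le.mp (hz.sum_signedPow n)).2
    have h3 := hB (z n).1
    push_cast
    nlinarith [hpq.pos]

theorem GoodSeq.integral_abs_sum_testFun_rpow_le (hz : GoodSeq μ p q ε F z)
    (hpq : p.HolderConjugate q) (hF : ∀ n, MemLp (F n) (ENNReal.ofReal p) μ)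
    (hB : ∀ n, ∫ ω, |F n ω| ^ p ∂μ ≤ B) (n : ℕ) :
    ∫ ω, |∑ j ∈ range n, testFun p F (z j) ω| ^ q ∂μ ≤ n * (2 ^ (q - 1) * (1 + B)) := by
  induction n with
  | zero => simp [Real.zero_rpow hpq.symm.ne_zero]
  | succ n ih =>
    have hh : ∀ j, MemLp (testFun p F (z j)) (ENNReal.ofReal q) μ := fun j =>
      memLp_testFun hpq hF (hz.measurableSet j)
    have hH : ∀ n, MemLp (fun ω => ∑ j ∈ range n, testFun p F (z j) ω) (ENNReal.ofReal q) μ :=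
      fun n => memLp_finsetSum _ fun j _ => hh _
    have i1 := (hH n).integrable_abs_rpow hpq.symm.pos
    have i2 := i1.indicator (hz.measurableSet n)
    have i3 := (hF (z n).1).integrable_abs_rpow hpq.pos
    have h1 : ∫ ω, |∑ j ∈ range (n + 1), testFun p F (z j) ω| ^ q ∂μ ≤
        ∫ ω, (|∑ j ∈ range n, testFun p F (z j) ω| ^ q +
          2 ^ (q - 1) * ((z n).2.indicator (fun ω => |∑ j ∈ range n, testFun p F (z j) ω| ^ q) ω
            + |F (z n).1 ω| ^ p)) ∂μ := by
      refine integral_mono ((hH _).integrable_abs_rpow hpq.symm.pos)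
        (i1.fun_add ((i2.fun_add i3).const_mul _)) fun ω => ?_
      simp only [sum_range_succ]
      by_cases hω : ω ∈ (z n).2
      · rw [Set.indicator_of_mem hω]
        refine (abs_add_rpow_le_two_rpow hpq.symm.lt.le _ _).trans ?_
        have h4 := abs_testFun_rpow_le hpq F (z n) ω
        refine le_add_of_nonneg_of_le (by positivity) ?_
        gcongr
      · have h4 : testFun p F (z n) ω = 0 := Set.indicator_of_notMem hω _
        rw [Set.indicator_of_notMem hω, h4, add_zero]
        exact le_add_of_nonneg_right (by positivity)
    rw [integral_add i1 ((i2.fun_add i3).const_mul _), integral_const_mul, integral_add i2 i3,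
      integral_indicator (hz.measurableSet n)] at h1
    have h2 : (2 : ℝ) ^ (q - 1) * ((∫ ω in (z n).2, |∑ j ∈ range n, testFun p F (z j) ω| ^ q ∂μ)
        + ∫ ω, |F (z n).1 ω| ^ p ∂μ) ≤ 2 ^ (q - 1) * (1 + B) := by
      gcongr
      · exact hz.sum_testFun n
      · exact hB _
    push_cast
    linarith

theorem GoodSeq.le_integral_sum_testFun_mul_sum (hz : GoodSeq μ p q ε F z) (hε : 0 < ε)
    (hpq : p.HolderConjugate q) (hF : ∀ n, MemLp (F n) (ENNReal.ofReal p) μ) (n : ℕ) :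
    n * (ε / 2) ≤
      ∫ ω, (∑ j ∈ range n, testFun p F (z j) ω) * ∑ j ∈ range n, F (z j).1 ω ∂μ := by
  induction n with
  | zero => simp
  | succ n ih =>
    have hh : ∀ j, MemLp (testFun p F (z j)) (ENNReal.ofReal q) μ := fun j =>
      memLp_testFun hpq hF (hz.measurableSet j)
    have hH : MemLp (fun ω => ∑ j ∈ range n, testFun p F (z j) ω) (ENNReal.ofReal q) μ :=
      memLp_finsetSum _ fun j _ => hh _
    have hS : MemLp (fun ω => ∑ j ∈ range n, F (z j).1 ω) (ENNReal.ofReal p) μ :=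
      memLp_finsetSum _ fun j _ => hF _
    have i1 := integrable_mul_of_holderConjugate hpq hS hH
    have i2 := integrable_mul_of_holderConjugate hpq hS (hh n)
    have i3 := integrable_mul_of_holderConjugate hpq (hF (z n).1) hH
    have i4 := integrable_mul_of_holderConjugate hpq (hF (z n).1) (hh n)
    have h1 : ∫ ω, (∑ j ∈ range (n + 1), testFun p F (z j) ω) *
          ∑ j ∈ range (n + 1), F (z j).1 ω ∂μ =
        (∫ ω, (∑ j ∈ range n, testFun p F (z j) ω) * ∑ j ∈ range n, F (z j).1 ω ∂μ) +
        (∫ ω, testFun p F (z n) ω * ∑ j ∈ range n, F (z j).1 ω ∂μ) +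
        (∫ ω, (∑ j ∈ range n, testFun p F (z j) ω) * F (z n).1 ω ∂μ) +
        ∫ ω, testFun p F (z n) ω * F (z n).1 ω ∂μ := by
      rw [← integral_add i1 i2, ← integral_add (i1.fun_add i2) i3,
        ← integral_add ((i1.fun_add i2).fun_add i3) i4]
      congr 1 with ω
      simp only [sum_range_succ]
      ring
    have hn : (n : ℝ) * (ε / 4 / (n + 1)) ≤ ε / 4 := by
      rw [← mul_div_assoc, div_le_iff₀ (by positivity)]
      nlinarith
    have h2 : -(ε / 4) ≤ ∫ ω, testFun p F (z n) ω * ∑ j ∈ range n, F (z j).1 ω ∂μ := by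
      simp only [mul_sum]
      rw [integral_finsetSum _ fun j _ => integrable_mul_of_holderConjugate hpq (hF _) (hh n)]
      have : ∑ j ∈ range n, -(ε / 4 / (n + 1)) ≤
          ∑ j ∈ range n, ∫ ω, testFun p F (z n) ω * F (z j).1 ω ∂μ :=
        sum_le_sum fun j hj => (abs_le.mp (hz.testFun_new n j (mem_range.mp hj))).1
      rw [sum_const, card_range, nsmul_eq_mul] at this
      linarith
    have h3 : -(ε / 4) ≤ ∫ ω, (∑ j ∈ range n, testFun p F (z j) ω) * F (z n).1 ω ∂μ := by
      simp only [sum_mul]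
      rw [integral_finsetSum _ fun j _ => integrable_mul_of_holderConjugate hpq (hF _) (hh j)]
      have : ∑ j ∈ range n, -(ε / 4 / (n + 1)) ≤
          ∑ j ∈ range n, ∫ ω, testFun p F (z j) ω * F (z n).1 ω ∂μ :=
        sum_le_sum fun j hj => (abs_le.mp (hz.testFun_old n j (mem_range.mp hj))).1
      rw [sum_const, card_range, nsmul_eq_mul] at this
      linarith
    have h4 : ε ≤ ∫ ω, testFun p F (z n) ω * F (z n).1 ω ∂μ := by
      rw [integral_testFun_mul (hz.measurableSet n)]
      simpa only [signedPow_mul_self hpq.pos] using hz.mass n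
    rw [h1]
    push_cast
    linarith

theorem GoodSeq.le_rpow_integral (hz : GoodSeq μ p q ε F z) (hε : 0 < ε)
    (hpq : p.HolderConjugate q) (hF : ∀ n, MemLp (F n) (ENNReal.ofReal p) μ)
    (hB : ∀ n, ∫ ω, |F n ω| ^ p ∂μ ≤ B) (hB0 : 0 ≤ B) {n : ℕ} (hn : 0 < n) :
    ε / 2 / (2 ^ (q - 1) * (1 + B)) ^ (1 / q) ≤
      (n : ℝ) ^ (-(1 / p)) * (∫ ω, |∑ j ∈ range n, F (z j).1 ω| ^ p ∂μ) ^ (1 / p) := by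
  have hn' : (0 : ℝ) < n := by exact_mod_cast hn
  set I := (∫ ω, |∑ j ∈ range n, F (z j).1 ω| ^ p ∂μ) ^ (1 / p)
  have hI : 0 ≤ I := Real.rpow_nonneg (integral_nonneg fun ω => by positivity) _
  set C := 2 ^ (q - 1) * (1 + B)
  have hC : 0 < C := by positivity
  have hq := hpq.symm.pos
  have h1 : n * (ε / 2) ≤ (n * C) ^ (1 / q) * I := by
    refine (hz.le_integral_sum_testFun_mul_sum hε hpq hF n).trans <| (le_abs_self _).trans <|
      (abs_integral_mul_le_rpow hpq (memLp_finsetSum _ fun j _ => hF _)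
        (memLp_finsetSum _ fun j _ => memLp_testFun hpq hF (hz.measurableSet j))).trans ?_
    gcongr
    exact hz.integral_abs_sum_testFun_rpow_le hpq hF hB n
  have h2 : (n : ℝ) ^ (1 / q) = n * (n : ℝ) ^ (-(1 / p)) := by
    nth_rewrite 2 [← Real.rpow_one (n : ℝ)]
    rw [← Real.rpow_add hn']
    congr 1
    have := hpq.inv_add_inv_eq_one
    simp only [one_div]
    linarith
  rw [Real.mul_rpow hn'.le hC.le, h2] at h1
  rw [div_le_iff₀ (by positivity)]
  refine le_of_mul_le_mul_left (h1.trans_eq ?_) hn'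
  ring

theorem GoodSeq.rpow_integral_le (hz : GoodSeq μ p q ε F z) (hpq : p.HolderConjugate q)
    (hp2 : p < 2) (hF : ∀ n, MemLp (F n) (ENNReal.ofReal p) μ)
    (hB : ∀ n, ∫ ω, |F n ω| ^ p ∂μ ≤ B) (hB0 : 0 ≤ B) {n : ℕ} (hn : 0 < n) :
    (n : ℝ) ^ (-(1 / p)) * (∫ ω, |∑ j ∈ range n, F (z j).1 ω| ^ p ∂μ) ^ (1 / p) ≤
      (2 + 6 * B) ^ (1 / p) := by
  have hn' : (0 : ℝ) < n := by exact_mod_cast hn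
  have hp := hpq.pos
  have h : (∫ ω, |∑ j ∈ range n, F (z j).1 ω| ^ p ∂μ) ^ (1 / p) ≤
      (n * (2 + 6 * B)) ^ (1 / p) :=
    Real.rpow_le_rpow (integral_nonneg fun ω => by positivity)
      (hz.integral_abs_sum_rpow_le hpq hp2 hF hB n) (by positivity)
  rw [Real.mul_rpow hn'.le (by positivity)] at h
  rw [Real.rpow_neg hn'.le, inv_mul_le_iff₀ (by positivity)]
  exact h

end Sequence

open Classical in
theorem exists_forall_goodSeq {p q : ℝ} (hpq : p.HolderConjugate q) {F : ℕ → Ω → ℝ}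
    (hF : ∀ n, MemLp (F n) (ENNReal.ofReal p) μ) {B : ℝ} (hB : ∀ n, ∫ ω, |F n ω| ^ p ∂μ ≤ B)
    (hweak : ∀ g : Ω → ℝ, MemLp g (ENNReal.ofReal q) μ →
      Tendsto (fun n => ∫ ω, g ω * F n ω ∂μ) atTop (nhds 0))
    (hnotui : ¬ UnifIntPow μ p F) :
    ∃ ε : ℝ, 0 < ε ∧ ∃ x : ℕ → ℕ × Set Ω, StrictMono (fun n => (x n).1) ∧
      ∀ m : ℕ → ℕ, StrictMono m → GoodSeq μ p q ε F (x ∘ m) := by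
  obtain ⟨ε, hε, hfreq⟩ :=
    exists_frequently_le_setIntegral (fun n => (hF n).integrable_abs_rpow hpq.pos) hnotui
  obtain ⟨x, hx⟩ := exists_seq_forall_image_range
    (Q := fun s x => (∀ y ∈ s, MeasurableSet y.2) → GoodStep μ p q ε F s x) (fun s => by
      by_cases hs : ∀ y ∈ s, MeasurableSet y.2
      · obtain ⟨x, hx⟩ := exists_goodStep hpq hF hB hweak hε hfreq s hs
        exact ⟨x, fun _ => hx⟩
      · exact ⟨(0, ∅), fun h => absurd h hs⟩)
  have hgood : ∀ N, GoodStep μ p q ε F ((Finset.range N).image x) (x N) := by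
    intro N
    induction N using Nat.strong_induction_on with
    | _ N ih =>
      refine hx N fun y hy => ?_
      obtain ⟨j, hj, rfl⟩ := Finset.mem_image.mp hy
      exact (ih j (Finset.mem_range.mp hj)).measurableSet
  have hmono : StrictMono fun n => (x n).1 := fun a b hab =>
    (hgood b).lt _ (Finset.mem_image_of_mem _ (Finset.mem_range.mpr hab))
  exact ⟨ε, hε, x, hmono, fun m hm => goodSeq_comp hε hgood hmono hm⟩

theorem norm_Lp_eq_rpow_integral {p : ℝ} (hp : 0 < p) (s : Lp ℝ (ENNReal.ofReal p) μ) :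
    ‖s‖ = (∫ ω, |s ω| ^ p ∂μ) ^ (1 / p) := by
  rw [Lp.norm_def, (Lp.memLp s).eLpNorm_eq_integral_rpow_norm (by simpa using hp)
    ENNReal.ofReal_ne_top, ENNReal.toReal_ofReal hp.le, ENNReal.toReal_ofReal, one_div]
  · rfl
  · exact Real.rpow_nonneg (integral_nonneg fun ω => by positivity) _

end Integrals

/-- (Commutative case of Proposition 5.6, assertion 2, second part.) -/
theorem statement19
    {Ω : Type*} [MeasurableSpace Ω] (μ : Measure Ω) [IsProbabilityMeasure μ]
    (hμ : Atomless μ)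
    (p : ℝ) (hp1 : 1 < p) (hp2 : p < 2)
    [Fact (1 ≤ ENNReal.ofReal p)]
    (f : ℕ → Lp ℝ (ENNReal.ofReal p) μ)
    (M : ℝ) (hM : ∀ n, ‖f n‖ ≤ M)
    (hweak : WeaklyNullLp μ (ENNReal.ofReal p) f)
    (hnotui : ¬ UnifIntPow μ p fun n => (f n : Ω → ℝ)) :
    ∃ k : ℕ → ℕ, StrictMono k ∧ ∃ c : ℝ, 0 < c ∧ ∀ m : ℕ → ℕ, StrictMono m →
      c ≤ Filter.liminf
        (fun n : ℕ => (n : ℝ) ^ (-(1 / p)) * ‖∑ j ∈ Finset.range n, f (k (m j))‖) atTop := by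
  set q := p.conjExponent
  have hpq : p.HolderConjugate q := Real.HolderConjugate.conjExponent hp1
  have hF : ∀ n, MemLp (f n) (ENNReal.ofReal p) μ := fun n => Lp.memLp _
  have hM0 : 0 ≤ M := (norm_nonneg _).trans (hM 0)
  have hI0 : ∀ n, 0 ≤ ∫ ω, |f n ω| ^ p ∂μ := fun n => integral_nonneg fun ω => by positivity
  have hB : ∀ n, ∫ ω, |f n ω| ^ p ∂μ ≤ M ^ p := by
    intro n
    have h := hM n
    rw [norm_Lp_eq_rpow_integral hpq.pos] at h
    have h' := Real.rpow_le_rpow (Real.rpow_nonneg (hI0 n) _) h hpq.nonneg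
    rwa [one_div, Real.rpow_inv_rpow (hI0 n) hpq.ne_zero] at h'
  have hB0 : 0 ≤ M ^ p := Real.rpow_nonneg hM0 _
  have hw : ∀ g : Ω → ℝ, MemLp g (ENNReal.ofReal q) μ →
      Tendsto (fun n => ∫ ω, g ω * f n ω ∂μ) atTop (nhds 0) := by
    intro g hg
    refine (hweak (ENNReal.ofReal q) hpq.ennrealOfReal.inv_add_inv_eq_one hg.toLp).congr
      fun n => integral_congr_ae ?_
    filter_upwards [hg.coeFn_toLp] with ω hω
    rw [hω, mul_comm]
  obtain ⟨ε, hε, x, hmono, hx⟩ := exists_forall_goodSeq hpq hF hB hw hnotui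
  refine ⟨fun n => (x n).1, hmono, ε / 2 / (2 ^ (q - 1) * (1 + M ^ p)) ^ (1 / q), by positivity,
    fun m hm => ?_⟩
  have hnorm : ∀ n, ‖∑ j ∈ Finset.range n, f (x (m j)).1‖ =
      (∫ ω, |∑ j ∈ Finset.range n, f ((x ∘ m) j).1 ω| ^ p ∂μ) ^ (1 / p) := by
    intro n
    rw [norm_Lp_eq_rpow_integral hpq.pos]
    congr 1
    refine integral_congr_ae ?_
    filter_upwards [Lp.coeFn_finsetSum (Finset.range n) fun j => f (x (m j)).1] with ω hω
    rw [hω, Finset.sum_apply]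
    rfl
  simp only [hnorm]
  refine le_liminf_of_le ?_ ?_
  · refine IsBoundedUnder.isCoboundedUnder_ge ⟨(2 + 6 * M ^ p) ^ (1 / p), ?_⟩
    rw [eventually_map]
    filter_upwards [eventually_gt_atTop 0] with n hn
    exact (hx m hm).rpow_integral_le hpq hp2 hF hB hB0 hn
  · filter_upwards [eventually_gt_atTop 0] with n hn
    exact (hx m hm).le_rpow_integral hε hpq hF hB hB0 hn

end
end
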